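/- Let C be an admissible capacity on X. Let E ⊆ X be a q-closed set with C(E) > 0 and let D ⊆ X be a q-open set with E ⊆q D. Then there exists a q-open set O ⊆ X such that E ⊆q O and Õ ⊆q D. -/

import Mathlib

open Set Metric Filter MeasureTheory ENNReal

noncomputable section

/-- A capacity on a metric space `X`: a monotone, countably subadditive
set function vanishing on the empty set, with values in `[0,∞]`. -/
structure Capacity (X : Type*) [MetricSpace X] where
  toFun : Set X → ℝ≥0∞
  empty' : toFun ∅ = 0
  mono' : ∀ ⦃A B : Set X⦄, A ⊆ B → toFun A ≤ toFun B
  subadd' : ∀ A : ℕ → Set X, toFun (⋃ n, A n) ≤ ∑' n, toFun (A n)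

variable {X : Type*} [MetricSpace X]

/-- The set of `q`-thick points of `A`: points `ξ` where the series
`∑ (2^{nγ} C(A ∩ B̄(ξ,2^{-n})))^{q-1}` diverges. -/
def Capacity.thick (C : Capacity X) (q γ : ℝ) (A : Set X) : Set X :=
  {ξ : X | ∑' n : ℕ,
    ((2 : ℝ≥0∞) ^ ((n : ℝ) * γ) * C.toFun (A ∩ closedBall ξ ((2 : ℝ) ^ (-(n : ℝ))))) ^ (q - 1) = ⊤}

/-- The `q`-fine closure of a set: `Ã = A ∪ b(A)`. -/
def Capacity.fineClosure (C : Capacity X) (q γ : ℝ) (A : Set X) : Set X :=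
  A ∪ C.thick q γ A

/-- The `q`-fine interior of a set: `A° = A \ b(X∖A)`. -/
def Capacity.fineInterior (C : Capacity X) (q γ : ℝ) (A : Set X) : Set X :=
  A \ C.thick q γ Aᶜ

/-- A set is `q`-closed if it contains all its `q`-thick points. -/
def Capacity.QClosed (C : Capacity X) (q γ : ℝ) (F : Set X) : Prop :=
  C.thick q γ F ⊆ F

/-- A set is `q`-open if its complement is `q`-closed. -/
def Capacity.QOpen (C : Capacity X) (q γ : ℝ) (A : Set X) : Prop :=
  C.QClosed q γ Aᶜ

/-- `A ⊆q B` : `A` is `q`-essentially contained in `B`, i.e. `C(A∖B) = 0`. -/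
def Capacity.Subq (C : Capacity X) (A B : Set X) : Prop := C.toFun (A \ B) = 0

/-- `A ∼q B` : `A` and `B` are `q`-equivalent, i.e. `C(AΔB) = 0`. -/
def Capacity.Eqq (C : Capacity X) (A B : Set X) : Prop :=
  C.toFun ((A \ B) ∪ (B \ A)) = 0

/-- A set `E` is `q`-quasi closed: there is an increasing sequence of compact
subsets `K m ⊆ E` with `C(E∖K m) → 0`. -/
def Capacity.QuasiClosed (C : Capacity X) (E : Set X) : Prop :=
  ∃ K : ℕ → Set X, Monotone K ∧ (∀ m, IsCompact (K m)) ∧ (∀ m, K m ⊆ E) ∧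
    Tendsto (fun m => C.toFun (E \ K m)) atTop (nhds 0)

/-- An admissible capacity: all the regularity, Kellogg, stratification,
patching and quasi-Lindelöf properties of the Bessel capacity `C_{2/q,q'}`. -/
structure Capacity.Admissible [CompactSpace X] [MeasurableSpace X] [BorelSpace X]
    (C : Capacity X) (q γ : ℝ) : Prop where
  finite : C.toFun univ ≠ ⊤
  outerRegular : ∀ E : Set X, C.toFun E = ⨅ (G : Set X) (_ : E ⊆ G) (_ : IsOpen G), C.toFun G
  contIncr : ∀ E : ℕ → Set X, Monotone E →
    Tendsto (fun i => C.toFun (E i)) atTop (nhds (C.toFun (⋃ i, E i)))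
  contDecrCompact : ∀ K : ℕ → Set X, (∀ i, IsCompact (K i)) → Antitone K →
    Tendsto (fun i => C.toFun (K i)) atTop (nhds (C.toFun (⋂ i, K i)))
  innerRegular : ∀ E : Set X, MeasurableSet E →
    C.toFun E = ⨆ (K : Set X) (_ : K ⊆ E) (_ : IsCompact K), C.toFun K
  kellogg : ∀ A : Set X, C.toFun (A \ C.thick q γ A) = 0
  closureBound : ∃ c : ℝ≥0∞, 1 ≤ c ∧ c ≠ ⊤ ∧
    ∀ A : Set X, C.toFun (C.fineClosure q γ A) ≤ c * C.toFun A
  closureQClosed : ∀ A : Set X, C.QClosed q γ (C.fineClosure q γ A)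
  stratification : ∀ E : Set X, C.QClosed q γ E → C.QuasiClosed E
  thickQuasi : ∀ E : Set X, C.QuasiClosed E → C.toFun (C.thick q γ E \ E) = 0
  openPatch : ∀ D : Set X, C.QOpen q γ D → ∀ ε : ℝ≥0∞, 0 < ε →
    ∃ ω : Set X, IsOpen ω ∧ C.toFun ω < ε ∧ IsOpen (D ∪ ω)
  quasiLindelof : ∀ 𝒟 : Set (Set X), (∀ D ∈ 𝒟, C.QOpen q γ D) →
    ∃ 𝒟' ⊆ 𝒟, 𝒟'.Countable ∧ C.toFun ((⋃₀ 𝒟) \ ⋃₀ 𝒟') = 0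

/-- A Borel measure is outer regular with respect to the `q`-topology. -/
def Capacity.OuterRegularQ [MeasurableSpace X] (C : Capacity X) (q γ : ℝ) (μ : Measure X) : Prop :=
  ∀ E : Set X, MeasurableSet E → μ E = ⨅ (Q : Set X) (_ : E ⊆ Q) (_ : C.QOpen q γ Q), μ Q

/-- A Borel measure is essentially absolutely continuous with respect to `C`. -/
def Capacity.EssAbsCont [MeasurableSpace X] (C : Capacity X) (q γ : ℝ) (μ : Measure X) : Prop :=
  ∀ Q : Set X, C.QOpen q γ Q → ∀ A : Set X, MeasurableSet A → C.toFun A = 0 → μ (Q \ A) = μ Q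

/-- A `q`-perfect measure: outer regular w.r.t. the `q`-topology and
essentially absolutely continuous w.r.t. `C`. -/
def Capacity.QPerfect [MeasurableSpace X] (C : Capacity X) (q γ : ℝ) (μ : Measure X) : Prop :=
  C.OuterRegularQ q γ μ ∧ C.EssAbsCont q γ μ

namespace Capacity

/-- A capacity, viewed as an outer measure. -/
def toOuterMeasure (C : Capacity X) : OuterMeasure X where
  measureOf := C.toFun
  empty := C.empty'
  mono h := C.mono' h
  iUnion_nat s _ := C.subadd' s

variable {C : Capacity X} {q γ : ℝ}

theorem toFun_union_le (C : Capacity X) (A B : Set X) :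
    C.toFun (A ∪ B) ≤ C.toFun A + C.toFun B :=
  measure_union_le (μ := C.toOuterMeasure) A B

theorem thick_mono (hq : 0 ≤ q - 1) {A B : Set X} (h : A ⊆ B) :
    C.thick q γ A ⊆ C.thick q γ B := by
  intro ξ hξ
  refine top_unique (hξ.symm.le.trans (ENNReal.tsum_le_tsum fun n => ?_))
  gcongr
  exact C.mono' (by gcongr)

theorem tsum_eq_top_of_tail_eq {f g : ℕ → ℝ≥0∞} {M : ℕ} (hf : ∀ n, f n ≠ ⊤)
    (hfg : ∀ n, f (n + M) = g (n + M)) (h : ∑' n, f n = ⊤) : ∑' n, g n = ⊤ := by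
  rw [← ENNReal.summable.sum_add_tsum_nat_add' (k := M)] at h
  have htail := (ENNReal.add_eq_top.1 h).resolve_left (ENNReal.sum_ne_top.2 fun n _ => hf n)
  simp only [hfg] at htail
  rw [← ENNReal.summable.sum_add_tsum_nat_add' (k := M), htail, add_top]

/-- Thickness of a set at a point depends only on the set near that point. -/
theorem thick_union_closed_subset (hfin : C.toFun univ ≠ ⊤) (hq : 0 ≤ q - 1) {A K : Set X}
    (hK : IsClosed K) : C.thick q γ (A ∪ K) ⊆ C.thick q γ A ∪ K := by
  intro ξ hξ
  by_contra hcon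
  rw [mem_union, not_or] at hcon
  obtain ⟨hA, hξK⟩ := hcon
  obtain ⟨r, hr, hball⟩ := Metric.nhds_basis_closedBall.mem_iff.1 (hK.isOpen_compl.mem_nhds hξK)
  obtain ⟨M, hM⟩ := exists_pow_lt_of_lt_one hr (by norm_num : (2⁻¹ : ℝ) < 1)
  have hlocal (n : ℕ) : (A ∪ K) ∩ closedBall ξ ((2 : ℝ) ^ (-((n + M : ℕ) : ℝ))) =
      A ∩ closedBall ξ ((2 : ℝ) ^ (-((n + M : ℕ) : ℝ))) := by
    have hsub : closedBall ξ ((2 : ℝ) ^ (-((n + M : ℕ) : ℝ))) ⊆ Kᶜ := by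
      refine (closedBall_subset_closedBall ?_).trans hball
      rw [Real.rpow_neg (by norm_num), Real.rpow_natCast, ← inv_pow]
      exact (pow_le_pow_of_le_one (by norm_num) (by norm_num) (Nat.le_add_left M n)).trans hM.le
    ext x
    constructor
    · rintro ⟨hx | hx, hxb⟩
      · exact ⟨hx, hxb⟩
      · exact absurd hx (hsub hxb)
    · rintro ⟨hx, hxb⟩
      exact ⟨Or.inl hx, hxb⟩
  have hterm (B : Set X) (n : ℕ) : ((2 : ℝ≥0∞) ^ ((n : ℝ) * γ) *
      C.toFun (B ∩ closedBall ξ ((2 : ℝ) ^ (-(n : ℝ))))) ^ (q - 1) ≠ ⊤ := by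
    refine ENNReal.rpow_ne_top_of_nonneg hq (ENNReal.mul_ne_top ?_ ?_)
    · exact ENNReal.rpow_ne_top_of_ne_zero (by norm_num) (by norm_num)
    · exact ne_top_of_le_ne_top hfin (C.mono' (subset_univ _))
  exact hA (tsum_eq_top_of_tail_eq (M := M) (hterm _) (fun n => by rw [hlocal]) hξ)

theorem QClosed.union_closed (hfin : C.toFun univ ≠ ⊤) (hq : 0 ≤ q - 1) {A K : Set X}
    (hA : C.QClosed q γ A) (hK : IsClosed K) : C.QClosed q γ (A ∪ K) :=
  (thick_union_closed_subset hfin hq hK).trans (union_subset_union_left K hA)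

theorem QOpen.diff_closed (hfin : C.toFun univ ≠ ⊤) (hq : 0 ≤ q - 1) {A K : Set X}
    (hA : C.QOpen q γ A) (hK : IsClosed K) : C.QOpen q γ (A \ K) := by
  rw [QOpen, sdiff_eq, compl_inter, compl_compl]
  exact QClosed.union_closed hfin hq hA hK

theorem QOpen.iUnion (hq : 0 ≤ q - 1) {ι : Sort*} {A : ι → Set X}
    (hA : ∀ i, C.QOpen q γ (A i)) : C.QOpen q γ (⋃ i, A i) := by
  rw [QOpen, compl_iUnion]
  exact subset_iInter fun i => (thick_mono hq (iInter_subset _ i)).trans (hA i)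

theorem QClosed.fineClosure_subset (hq : 0 ≤ q - 1) {A F : Set X} (hF : C.QClosed q γ F)
    (h : A ⊆ F) : C.fineClosure q γ A ⊆ F :=
  union_subset h ((thick_mono hq h).trans hF)

variable [CompactSpace X] [MeasurableSpace X] [BorelSpace X]

/-- Two quasi closed sets with null intersection: up to small capacity, one is covered by
a `q`-open set whose closure misses the other. -/
theorem Admissible.exists_qOpen_closure_disjoint (hC : C.Admissible q γ) (hq : 0 ≤ q - 1)
    {E F : Set X} (hE : C.QuasiClosed E) (hF : C.QuasiClosed F) (hEF : C.toFun (E ∩ F) = 0)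
    {ε : ℝ≥0∞} (hε : ε ≠ 0) :
    ∃ H, C.QOpen q γ H ∧ Disjoint (closure H) E ∧ C.toFun (F \ H) ≤ ε := by
  obtain ⟨c, hc1, hctop, hc⟩ := hC.closureBound
  have hc' : 1 + c ≠ ⊤ := ENNReal.add_ne_top.2 ⟨one_ne_top, hctop⟩
  have hδ : 0 < ε / (1 + c) := ENNReal.div_pos hε hc'
  obtain ⟨K, -, hK, hKE, hKlim⟩ := hE
  obtain ⟨L, -, hL, hLF, hLlim⟩ := hF
  obtain ⟨k, hk⟩ := (hKlim.eventually_lt_const hδ).exists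
  obtain ⟨l, hl⟩ := (hLlim.eventually_lt_const hδ).exists
  have hsmall : C.toFun ((E \ K k) ∪ (E ∩ F)) < ε / (1 + c) :=
    (C.toFun_union_le _ _).trans_lt (by rwa [hEF, add_zero])
  rw [hC.outerRegular] at hsmall
  simp only [iInf_lt_iff] at hsmall
  obtain ⟨ω, hω, hωo, hωlt⟩ := hsmall
  have hdisj : Disjoint (L l \ ω) (K k) := by
    rw [Set.disjoint_left]
    exact fun x hx hxK => hx.2 (hω (Or.inr ⟨hKE k hxK, hLF l hx.1⟩))
  obtain ⟨U, V, hUo, hVo, hU, hV, hUV⟩ :=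
    SeparatedNhds.of_isCompact_isCompact ((hL l).diff hωo) (hK k) hdisj
  refine ⟨U \ C.fineClosure q γ ω, ?_, ?_, ?_⟩
  · rw [QOpen, sdiff_eq, compl_inter, compl_compl, union_comm]
    exact (hC.closureQClosed ω).union_closed hC.finite hq hUo.isClosed_compl
  · have hV' : closure (U \ C.fineClosure q γ ω) ⊆ Vᶜ :=
      closure_minimal (sdiff_subset.trans hUV.subset_compl_right) hVo.isClosed_compl
    have hω' : closure (U \ C.fineClosure q γ ω) ⊆ ωᶜ :=
      closure_minimal (fun x hx hxω => hx.2 (Or.inl hxω)) hωo.isClosed_compl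
    rw [Set.disjoint_left]
    intro x hx hxE
    by_cases hxK : x ∈ K k
    · exact hV' hx (hV hxK)
    · exact hω' hx (hω (Or.inl ⟨hxE, hxK⟩))
  · have hsub : F \ (U \ C.fineClosure q γ ω) ⊆ (F \ L l) ∪ C.fineClosure q γ ω := by
      rintro x ⟨hxF, hx⟩
      by_cases hxL : x ∈ L l
      · by_contra h
        have hxω : x ∉ C.fineClosure q γ ω := fun h' => h (Or.inr h')
        exact hx ⟨hU ⟨hxL, fun h' => hxω (Or.inl h')⟩, hxω⟩
      · exact Or.inl ⟨hxF, hxL⟩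
    calc C.toFun (F \ (U \ C.fineClosure q γ ω))
        ≤ C.toFun (F \ L l) + C.toFun (C.fineClosure q γ ω) :=
          (C.mono' hsub).trans (C.toFun_union_le _ _)
      _ ≤ ε / (1 + c) + c * (ε / (1 + c)) := by
          gcongr
          exact (hc ω).trans (by gcongr)
      _ = (1 + c) * (ε / (1 + c)) := by ring
      _ = ε := ENNReal.mul_div_cancel (by simp) hc'

theorem Admissible.exists_qOpen_seq_closure_disjoint (hC : C.Admissible q γ) (hq : 0 ≤ q - 1)
    {E F : Set X} (hE : C.QuasiClosed E) (hF : C.QuasiClosed F) (hEF : C.toFun (E ∩ F) = 0) :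
    ∃ H : ℕ → Set X, (∀ n, C.QOpen q γ (H n)) ∧ (∀ n, Disjoint (closure (H n)) E) ∧
      C.Subq F (⋃ n, H n) := by
  choose H hHo hHE hHF using fun n : ℕ =>
    hC.exists_qOpen_closure_disjoint hq hE hF hEF (ε := (n : ℝ≥0∞)⁻¹)
      (ENNReal.inv_ne_zero.2 (ENNReal.natCast_ne_top n))
  refine ⟨H, hHo, hHE, le_antisymm ?_ zero_le⟩
  refine ge_of_tendsto' ENNReal.tendsto_inv_nat_nhds_zero fun n => ?_
  exact (C.mono' (sdiff_subset_sdiff_right (subset_iUnion H n))).trans (hHF n)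

/-- Two quasi closed sets with null intersection are separated, up to null sets,
by disjoint `q`-open sets. -/
theorem Admissible.exists_disjoint_qOpen (hC : C.Admissible q γ) (hq : 0 ≤ q - 1)
    {E F : Set X} (hE : C.QuasiClosed E) (hF : C.QuasiClosed F) (hEF : C.toFun (E ∩ F) = 0) :
    ∃ O P : Set X, C.QOpen q γ O ∧ C.QOpen q γ P ∧ Disjoint O P ∧ C.Subq E O ∧ C.Subq F P := by
  obtain ⟨H, hHo, hHE, hHF⟩ := hC.exists_qOpen_seq_closure_disjoint hq hE hF hEF
  obtain ⟨G, hGo, hGF, hGE⟩ :=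
    hC.exists_qOpen_seq_closure_disjoint hq hF hE (by rwa [inter_comm])
  have hclosed (A : ℕ → Set X) (n : ℕ) : IsClosed (⋃ j ∈ Iic n, closure (A j)) :=
    (finite_Iic n).isClosed_biUnion fun _ _ => isClosed_closure
  have hcover {A B : ℕ → Set X} {S : Set X} (hA : C.Subq S (⋃ n, A n))
      (hB : ∀ n, Disjoint (closure (B n)) S) :
      C.Subq S (⋃ n, A n \ ⋃ j ∈ Iic n, closure (B j)) := by
    refine le_antisymm ((C.mono' ?_).trans hA.le) zero_le
    rintro x ⟨hxS, hx⟩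
    refine ⟨hxS, fun hxA => hx ?_⟩
    obtain ⟨n, hn⟩ := mem_iUnion.1 hxA
    refine mem_iUnion.2 ⟨n, hn, fun hxB => ?_⟩
    obtain ⟨j, -, hj⟩ := mem_iUnion₂.1 hxB
    exact Set.disjoint_left.1 (hB j) hj hxS
  refine ⟨⋃ n, G n \ ⋃ j ∈ Iic n, closure (H j), ⋃ n, H n \ ⋃ j ∈ Iic n, closure (G j),
    QOpen.iUnion hq fun n => (hGo n).diff_closed hC.finite hq (hclosed H n),
    QOpen.iUnion hq fun n => (hHo n).diff_closed hC.finite hq (hclosed G n),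
    ?_, hcover hGE hHE, hcover hHF hGF⟩
  rw [Set.disjoint_left]
  intro x hxG hxH
  obtain ⟨m, hm, hm'⟩ := mem_iUnion.1 hxG
  obtain ⟨n, hn, hn'⟩ := mem_iUnion.1 hxH
  rcases le_total m n with h | h
  · exact hn' (mem_biUnion (mem_Iic.2 h) (subset_closure hm))
  · exact hm' (mem_biUnion (mem_Iic.2 h) (subset_closure hn))

end Capacity


theorem stmt12 {X : Type*} [MetricSpace X] [CompactSpace X] [MeasurableSpace X] [BorelSpace X]
    (N : ℕ) (hN : 2 ≤ N) (q γ : ℝ) (hq : ((N : ℝ) + 1) / ((N : ℝ) - 1) ≤ q)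
    (hγ : γ = (N : ℝ) - 1 - 2 / (q - 1))
    (C : Capacity X) (hC : C.Admissible q γ)
    (E : Set X) (hE : C.QClosed q γ E) (hEpos : 0 < C.toFun E)
    (D : Set X) (hD : C.QOpen q γ D) (hED : C.Subq E D) :
    ∃ O : Set X, C.QOpen q γ O ∧ C.Subq E O ∧ C.Subq (C.fineClosure q γ O) D := by
  have hq1 : 0 ≤ q - 1 := by
    have hN' : (2 : ℝ) ≤ N := by exact_mod_cast hN
    have : 1 ≤ ((N : ℝ) + 1) / ((N : ℝ) - 1) := by
      rw [le_div_iff₀ (by linarith)]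
      linarith
    linarith
  have hED' : C.toFun (E ∩ Dᶜ) = 0 := by rwa [← sdiff_eq]
  obtain ⟨O, P, hO, hP, hOP, hEO, hDP⟩ := hC.exists_disjoint_qOpen hq1
    (hC.stratification E hE) (hC.stratification Dᶜ hD) hED'
  refine ⟨O, hO, hEO, le_antisymm ((C.mono' ?_).trans hDP.le) zero_le⟩
  exact fun x hx => ⟨hx.2, hP.fineClosure_subset hq1 hOP.subset_compl_right hx.1⟩
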